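/- For all nonzero vectors a, b in H, the image of the interval [0,1] under the function f(q) = ω_q(a⊗b) equals the closed interval [ (‖a‖·‖b‖ + min(|⟨a,b⟩|, √(‖a‖²·‖b‖² − |⟨a,b⟩|²)))/2 , ‖a‖·‖b‖ ]. -/

import Mathlib

open scoped ComplexInnerProductSpace

/-- The rank-one operator `a ⊗ b` on a complex Hilbert space, acting by
`(a ⊗ b) x = ⟨x, a⟩ · b` (i.e. `x ↦ ⟪a, x⟫ • b` in Mathlib's convention, where the
inner product is conjugate-linear in the first slot). -/
noncomputable def rankOne {H : Type*} [NormedAddCommGroup H] [InnerProductSpace ℂ H]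
    (a b : H) : H →L[ℂ] H :=
  (innerSL ℂ a).smulRight b

/-- The `q`-numerical radius `ω_q(A) = sup { |⟨Ax, y⟩| : ‖x‖ = ‖y‖ = 1, ⟨x, y⟩ = q }`. -/
noncomputable def qRad {H : Type*} [NormedAddCommGroup H] [InnerProductSpace ℂ H]
    (q : ℝ) (A : H →L[ℂ] H) : ℝ :=
  sSup {r : ℝ | ∃ x y : H, ‖x‖ = 1 ∧ ‖y‖ = 1 ∧ ⟪x, y⟫ = (q : ℂ) ∧ r = ‖⟪A x, y⟫‖}

/-- The angle between the complex lines spanned by `x` and `y`. -/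
noncomputable def lineAngle {H : Type*} [NormedAddCommGroup H] [InnerProductSpace ℂ H]
    (x y : H) : ℝ :=
  Real.arccos (‖⟪x, y⟫‖ / (‖x‖ * ‖y‖))

section LineAngle

variable {H : Type*} [NormedAddCommGroup H] [InnerProductSpace ℂ H]

attribute [local instance] InnerProductSpace.complexToReal

lemma lineAngle_nonneg (x y : H) : 0 ≤ lineAngle x y := Real.arccos_nonneg _

lemma lineAngle_le_pi_div_two (x y : H) : lineAngle x y ≤ Real.pi / 2 :=
  Real.arccos_le_pi_div_two.2 (by positivity)

lemma lineAngle_comm (x y : H) : lineAngle x y = lineAngle y x := by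
  rw [lineAngle, lineAngle, norm_inner_symm, mul_comm]

lemma cos_lineAngle (x y : H) :
    Real.cos (lineAngle x y) = ‖⟪x, y⟫‖ / (‖x‖ * ‖y‖) := by
  refine Real.cos_arccos ?_ ?_
  · have : 0 ≤ ‖⟪x, y⟫‖ / (‖x‖ * ‖y‖) := by positivity
    linarith
  · exact div_le_one_of_le₀ (norm_inner_le_norm x y) (by positivity)

lemma norm_mul_norm_mul_cos_lineAngle (x y : H) :
    ‖x‖ * ‖y‖ * Real.cos (lineAngle x y) = ‖⟪x, y⟫‖ := by
  rw [cos_lineAngle]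
  rcases eq_or_ne x 0 with rfl | hx
  · simp
  rcases eq_or_ne y 0 with rfl | hy
  · simp
  have := norm_ne_zero_iff.2 hx
  have := norm_ne_zero_iff.2 hy
  field_simp

lemma sin_lineAngle_nonneg (x y : H) : 0 ≤ Real.sin (lineAngle x y) :=
  Real.sin_nonneg_of_nonneg_of_le_pi (lineAngle_nonneg x y) (Real.arccos_le_pi _)

lemma norm_mul_norm_mul_sin_lineAngle (x y : H) :
    ‖x‖ * ‖y‖ * Real.sin (lineAngle x y) =
      Real.sqrt (‖x‖ ^ 2 * ‖y‖ ^ 2 - ‖⟪x, y⟫‖ ^ 2) := by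
  rw [← norm_mul_norm_mul_cos_lineAngle,
    ← Real.sqrt_sq (mul_nonneg (by positivity : 0 ≤ ‖x‖ * ‖y‖) (sin_lineAngle_nonneg x y)),
    mul_pow _ (Real.sin _), Real.sin_sq]
  congr 1
  ring

lemma lineAngle_le_angle (x y : H) : lineAngle x y ≤ InnerProductGeometry.angle x y := by
  refine Real.arccos_le_arccos ?_
  gcongr
  exact Complex.re_le_norm _

lemma lineAngle_eq_angle {x y : H} (h : ⟪x, y⟫ = (‖⟪x, y⟫‖ : ℂ)) :
    lineAngle x y = InnerProductGeometry.angle x y := by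
  have h' : inner ℝ x y = ‖⟪x, y⟫‖ := by
    rw [real_inner_eq_re_inner ℂ, h]
    simp
  rw [lineAngle, InnerProductGeometry.angle, h']

lemma lineAngle_smul_left {w : ℂ} (hw : ‖w‖ = 1) (x y : H) :
    lineAngle (w • x) y = lineAngle x y := by
  simp [lineAngle, norm_smul, hw]

lemma exists_lineAngle_eq_angle (x y : H) :
    ∃ w : ℂ, ‖w‖ = 1 ∧ lineAngle x y = InnerProductGeometry.angle (w • x) y := by
  obtain ⟨w, hw, h⟩ := RCLike.exists_norm_eq_mul_self ⟪x, y⟫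
  have hc : ‖(starRingEnd ℂ) w‖ = 1 := by simpa using hw
  refine ⟨(starRingEnd ℂ) w, hc, ?_⟩
  rw [← lineAngle_smul_left hc, lineAngle_eq_angle]
  rw [inner_smul_left, Complex.conj_conj, norm_mul, hw, one_mul]
  exact h.symm

lemma lineAngle_triangle (x y z : H) : lineAngle x z ≤ lineAngle x y + lineAngle y z := by
  obtain ⟨u, hu, hxy⟩ := exists_lineAngle_eq_angle x y
  obtain ⟨v, hv, hzy⟩ := exists_lineAngle_eq_angle z y
  calc lineAngle x z = lineAngle (u • x) (v • z) := by
        rw [lineAngle_smul_left hu, lineAngle_comm, ← lineAngle_smul_left hv, lineAngle_comm]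
    _ ≤ InnerProductGeometry.angle (u • x) (v • z) := lineAngle_le_angle _ _
    _ ≤ InnerProductGeometry.angle (u • x) y + InnerProductGeometry.angle y (v • z) :=
        InnerProductGeometry.angle_le_angle_add_angle _ _ _
    _ = lineAngle x y + lineAngle y z := by
        rw [hxy, lineAngle_comm y z, hzy, InnerProductGeometry.angle_comm y]

lemma lineAngle_eq_of_inner_eq_cos {x y : H} {θ : ℝ} (hx : ‖x‖ = 1) (hy : ‖y‖ = 1)
    (hθ : θ ∈ Set.Icc 0 (Real.pi / 2)) (h : ⟪x, y⟫ = (Real.cos θ : ℂ)) :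
    lineAngle x y = θ := by
  have hcos : 0 ≤ Real.cos θ :=
    Real.cos_nonneg_of_mem_Icc ⟨by linarith [hθ.1, Real.pi_pos], hθ.2⟩
  rw [lineAngle, h, hx, hy, Complex.norm_real, Real.norm_of_nonneg hcos, mul_one, div_one,
    Real.arccos_cos hθ.1 (by linarith [hθ.2, Real.pi_pos])]

lemma norm_inner_mul_norm_inner_le {a b x y : H} (hx : ‖x‖ = 1) (hy : ‖y‖ = 1) :
    ‖⟪a, x⟫‖ * ‖⟪b, y⟫‖ ≤
      ‖a‖ * ‖b‖ * ((1 + Real.cos (lineAngle a b - lineAngle x y)) / 2) := by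
  set α := lineAngle a x with hα
  set β := lineAngle b y with hβ
  have h₁ : lineAngle a b - lineAngle x y ≤ α + β := by
    have := lineAngle_triangle a x b
    have := lineAngle_triangle x y b
    rw [lineAngle_comm y b] at this
    linarith
  have h₂ : lineAngle x y - lineAngle a b ≤ α + β := by
    have := lineAngle_triangle x a y
    have := lineAngle_triangle a b y
    rw [lineAngle_comm x a] at *
    linarith
  have h₃ : Real.cos (α + β) ≤ Real.cos (lineAngle a b - lineAngle x y) := by
    rw [← Real.cos_abs (lineAngle a b - lineAngle x y)]
    refine Real.cos_le_cos_of_nonneg_of_le_pi (abs_nonneg _) ?_ (abs_le.2 ⟨?_, h₁⟩)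
    · linarith [lineAngle_le_pi_div_two a x, lineAngle_le_pi_div_two b y]
    · linarith
  have h₄ : Real.cos α * Real.cos β ≤
      (1 + Real.cos (lineAngle a b - lineAngle x y)) / 2 := by
    have := Real.cos_le_one (α - β)
    rw [Real.cos_sub] at this
    rw [Real.cos_add] at h₃
    linarith
  calc ‖⟪a, x⟫‖ * ‖⟪b, y⟫‖ = ‖a‖ * ‖b‖ * (Real.cos α * Real.cos β) := by
        rw [← norm_mul_norm_mul_cos_lineAngle a x, ← norm_mul_norm_mul_cos_lineAngle b y, hx, hy]
        ring
    _ ≤ _ := by gcongr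

lemma exists_unit_inner_eq_zero (hdim : 2 ≤ Module.rank ℂ H) (e : H) :
    ∃ f : H, ‖f‖ = 1 ∧ ⟪e, f⟫ = 0 := by
  have hne : (ℂ ∙ e)ᗮ ≠ ⊥ := by
    intro h
    have htop : (ℂ ∙ e) = ⊤ := (Submodule.orthogonal_eq_bot_iff).1 h
    have h₁ : Module.rank ℂ (ℂ ∙ e) ≤ 1 := by
      simpa using rank_span_le (R := ℂ) ({e} : Set H)
    rw [htop, rank_top] at h₁
    exact absurd (hdim.trans h₁) (by norm_num)
  obtain ⟨v, hv, hv0⟩ := Submodule.exists_mem_ne_zero_of_ne_bot hne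
  refine ⟨((‖v‖⁻¹ : ℝ) : ℂ) • v, ?_, ?_⟩
  · rw [norm_smul, Complex.norm_real, norm_inv, norm_norm, inv_mul_cancel₀ (norm_ne_zero_iff.2 hv0)]
  · rw [inner_smul_right, (Submodule.mem_orthogonal_singleton_iff_inner_right).1 hv, mul_zero]

lemma exists_unit_inner_eq_zero_smul_eq (hdim : 2 ≤ Module.rank ℂ H) {e h : H}
    (heh : ⟪e, h⟫ = 0) : ∃ f : H, ‖f‖ = 1 ∧ ⟪e, f⟫ = 0 ∧ h = (‖h‖ : ℂ) • f := by
  rcases eq_or_ne h 0 with rfl | h0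
  · obtain ⟨f, hf, hef⟩ := exists_unit_inner_eq_zero hdim e
    exact ⟨f, hf, hef, by simp⟩
  · have hn := norm_ne_zero_iff.2 h0
    refine ⟨((‖h‖⁻¹ : ℝ) : ℂ) • h, ?_, ?_, ?_⟩
    · rw [norm_smul, Complex.norm_real, norm_inv, norm_norm, inv_mul_cancel₀ hn]
    · rw [inner_smul_right, heh, mul_zero]
    · rw [smul_smul, ← Complex.ofReal_mul, mul_inv_cancel₀ hn, Complex.ofReal_one, one_smul]

/-- The unit vector at angle `t` from `e` towards `f`. -/
noncomputable def circleVec (e f : H) (t : ℝ) : H :=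
  (Real.cos t : ℂ) • e + (Real.sin t : ℂ) • f

lemma inner_circleVec {e f : H} (he : ‖e‖ = 1) (hf : ‖f‖ = 1) (hef : ⟪e, f⟫ = 0) (s t : ℝ) :
    ⟪circleVec e f s, circleVec e f t⟫ = (Real.cos (t - s) : ℂ) := by
  have hfe : ⟪f, e⟫ = 0 := inner_eq_zero_symm.1 hef
  simp only [circleVec, inner_add_left, inner_add_right, inner_smul_left, inner_smul_right,
    inner_self_eq_norm_sq_to_K, he, hf, hef, hfe, Complex.conj_ofReal, Real.cos_sub]
  push_cast
  simp [mul_comm]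

lemma norm_circleVec {e f : H} (he : ‖e‖ = 1) (hf : ‖f‖ = 1) (hef : ⟪e, f⟫ = 0) (t : ℝ) :
    ‖circleVec e f t‖ = 1 := by
  have h := inner_circleVec he hf hef t t
  rw [inner_self_eq_norm_sq_to_K, sub_self, Real.cos_zero] at h
  exact (pow_eq_one_iff_of_nonneg (norm_nonneg _) two_ne_zero).1 (Complex.ofReal_injective
    ((Complex.ofReal_pow _ _).trans h))

lemma exists_eq_smul_circleVec (hdim : 2 ≤ Module.rank ℂ H) {a b : H} (ha : a ≠ 0) :
    ∃ (e f : H) (w : ℂ), ‖e‖ = 1 ∧ ‖f‖ = 1 ∧ ⟪e, f⟫ = 0 ∧ ‖w‖ = 1 ∧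
      a = (‖a‖ : ℂ) • circleVec e f 0 ∧
      b = (w * ‖b‖) • circleVec e f (lineAngle a b) := by
  have hn := norm_ne_zero_iff.2 ha
  have hnC : (‖a‖ : ℂ) ≠ 0 := by exact_mod_cast hn
  obtain ⟨v, hv, hvab⟩ := RCLike.exists_norm_eq_mul_self ⟪a, b⟫
  have hv0 : v ≠ 0 := norm_ne_zero_iff.1 (by simp [hv])
  set e : H := (‖a‖ : ℂ)⁻¹ • a with he_def
  have hae : a = (‖a‖ : ℂ) • e := by rw [he_def, smul_smul, mul_inv_cancel₀ hnC, one_smul]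
  have he : ‖e‖ = 1 := by simp [he_def, norm_smul, hn]
  set c : ℝ := ‖b‖ * Real.cos (lineAngle a b) with hc
  set s : ℝ := ‖b‖ * Real.sin (lineAngle a b) with hs
  have hevb : ⟪e, v • b⟫ = (c : ℂ) := by
    have h₁ : (‖a‖ : ℂ) * c = v * ⟪a, b⟫ := by
      refine Eq.trans ?_ hvab
      rw [← Complex.ofReal_mul, hc, ← mul_assoc, norm_mul_norm_mul_cos_lineAngle]
      rfl
    rw [he_def, inner_smul_left, inner_smul_right, ← h₁]
    simp [hnC]
  set h : H := v • b - (c : ℂ) • e with hh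
  have heh : ⟪e, h⟫ = 0 := by
    rw [hh, inner_sub_right, hevb, inner_smul_right, inner_self_eq_norm_sq_to_K, he]
    simp
  have hvb : v • b = (c : ℂ) • e + h := by rw [hh]; abel
  have hnorm : ‖h‖ = s := by
    have h₁ : ‖v • b‖ * ‖v • b‖ = ‖(c : ℂ) • e‖ * ‖(c : ℂ) • e‖ + ‖h‖ * ‖h‖ := by
      rw [hvb]
      exact norm_add_sq_eq_norm_sq_add_norm_sq_of_inner_eq_zero _ _
        (by rw [inner_smul_left, heh, mul_zero])
    rw [norm_smul, norm_smul, hv, he, Complex.norm_real, one_mul, mul_one, Real.norm_eq_abs,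
      abs_mul_abs_self] at h₁
    have h₂ : ‖h‖ ^ 2 = s ^ 2 := by
      rw [hs, mul_pow, Real.sin_sq]
      rw [hc] at h₁
      linear_combination -h₁
    exact (sq_eq_sq₀ (norm_nonneg _)
      (mul_nonneg (norm_nonneg _) (sin_lineAngle_nonneg a b))).1 h₂
  obtain ⟨f, hf, hef, hhf⟩ := exists_unit_inner_eq_zero_smul_eq hdim heh
  refine ⟨e, f, v⁻¹, he, hf, hef, by simp [hv], by simpa [circleVec] using hae, ?_⟩
  rw [mul_smul, eq_inv_smul_iff₀ hv0, hvb, hhf, hnorm, hc, hs, circleVec, smul_add,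
    Complex.ofReal_mul, Complex.ofReal_mul, mul_smul, mul_smul]

lemma norm_inner_rankOne (a b x y : H) :
    ‖⟪rankOne a b x, y⟫‖ = ‖⟪a, x⟫‖ * ‖⟪b, y⟫‖ := by
  simp [rankOne, norm_inner_symm x a, mul_comm]

lemma qRad_cos_rankOne (hdim : 2 ≤ Module.rank ℂ H) {a : H} (ha : a ≠ 0) (b : H)
    {θ : ℝ} (hθ : θ ∈ Set.Icc 0 (Real.pi / 2)) :
    qRad (Real.cos θ) (rankOne a b) =
      ‖a‖ * ‖b‖ * ((1 + Real.cos (lineAngle a b - θ)) / 2) := by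
  refine IsGreatest.csSup_eq ⟨?_, ?_⟩
  · obtain ⟨e, f, w, he, hf, hef, hw, hae, hbe⟩ := exists_eq_smul_circleVec hdim (b := b) ha
    set φ := lineAngle a b
    refine ⟨circleVec e f ((φ - θ) / 2), circleVec e f ((φ + θ) / 2),
      norm_circleVec he hf hef _, norm_circleVec he hf hef _, ?_, ?_⟩
    · rw [inner_circleVec he hf hef]
      congr 2
      ring
    · have hA : ‖⟪a, circleVec e f ((φ - θ) / 2)⟫‖ =
          ‖a‖ * |Real.cos ((φ - θ) / 2)| := by
        conv_lhs => rw [hae]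
        rw [inner_smul_left, inner_circleVec he hf hef, norm_mul, RCLike.norm_conj,
          Complex.norm_real, Complex.norm_real, norm_norm, sub_zero, Real.norm_eq_abs]
      have hB : ‖⟪b, circleVec e f ((φ + θ) / 2)⟫‖ =
          ‖b‖ * |Real.cos ((φ - θ) / 2)| := by
        conv_lhs => rw [hbe]
        rw [inner_smul_left, inner_circleVec he hf hef, norm_mul, RCLike.norm_conj, norm_mul, hw,
          Complex.norm_real, Complex.norm_real, norm_norm, one_mul, Real.norm_eq_abs,
          ← Real.cos_neg]
        congr 3
        ring
      have hcos : Real.cos (φ - θ) = 2 * Real.cos ((φ - θ) / 2) ^ 2 - 1 := by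
        rw [← Real.cos_two_mul]
        congr 1
        ring
      rw [norm_inner_rankOne, hA, hB, hcos, ← sq_abs (Real.cos ((φ - θ) / 2))]
      ring
  · rintro r ⟨x, y, hx, hy, hxy, rfl⟩
    rw [norm_inner_rankOne, ← lineAngle_eq_of_inner_eq_cos hx hy hθ hxy]
    exact norm_inner_mul_norm_inner_le hx hy

end LineAngle

lemma image_cos_Icc_zero_pi_div_two :
    Real.cos '' Set.Icc 0 (Real.pi / 2) = Set.Icc 0 1 := by
  ext q
  constructor
  · rintro ⟨θ, hθ, rfl⟩
    exact ⟨Real.cos_nonneg_of_mem_Icc ⟨by linarith [hθ.1, Real.pi_pos], hθ.2⟩,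
      Real.cos_le_one θ⟩
  · rintro ⟨h0, h1⟩
    exact ⟨Real.arccos q, ⟨Real.arccos_nonneg q, Real.arccos_le_pi_div_two.2 h0⟩,
      Real.cos_arccos (by linarith) h1⟩

lemma image_cos_sub_Icc {φ : ℝ} (hφ : φ ∈ Set.Icc 0 (Real.pi / 2)) :
    (fun θ => Real.cos (φ - θ)) '' Set.Icc 0 (Real.pi / 2) =
      Set.Icc (min (Real.cos φ) (Real.sin φ)) 1 := by
  obtain ⟨h0, h1⟩ := hφ
  have hcont : Continuous fun θ => Real.cos (φ - θ) := by fun_prop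
  refine Set.Subset.antisymm ?_ ?_
  · rintro _ ⟨θ, ⟨hθ0, hθ1⟩, rfl⟩
    refine ⟨?_, Real.cos_le_one _⟩
    rcases le_total θ φ with h | h
    · refine (min_le_left _ _).trans ?_
      exact Real.cos_le_cos_of_nonneg_of_le_pi (by linarith) (by linarith) (by linarith)
    · refine (min_le_right _ _).trans ?_
      change Real.sin φ ≤ Real.cos (φ - θ)
      rw [← Real.cos_pi_div_two_sub, ← Real.cos_neg (φ - θ)]
      exact Real.cos_le_cos_of_nonneg_of_le_pi (by linarith) (by linarith) (by linarith)
  · rcases min_choice (Real.cos φ) (Real.sin φ) with h | h <;> rw [h]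
    · have := intermediate_value_Icc h0 hcont.continuousOn
      simp only [sub_zero, sub_self, Real.cos_zero] at this
      exact this.trans (Set.image_mono (Set.Icc_subset_Icc_right h1))
    · have := intermediate_value_Icc' h1 hcont.continuousOn
      simp only [sub_self, Real.cos_zero] at this
      rw [← neg_sub, Real.cos_neg, Real.cos_pi_div_two_sub] at this
      exact this.trans (Set.image_mono (Set.Icc_subset_Icc_left h0))

/-- The image of `[0, 1]` under `q ↦ ω_q(a ⊗ b)`. -/
theorem stmt11 {H : Type*} [NormedAddCommGroup H] [InnerProductSpace ℂ H] [CompleteSpace H]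
    (hdim : 2 ≤ Module.rank ℂ H) (a b : H) (ha : a ≠ 0) (hb : b ≠ 0) :
    (fun q : ℝ => qRad q (rankOne a b)) '' Set.Icc (0 : ℝ) 1 =
      Set.Icc
        ((‖a‖ * ‖b‖ +
            min ‖⟪a, b⟫‖ (Real.sqrt (‖a‖ ^ 2 * ‖b‖ ^ 2 - ‖⟪a, b⟫‖ ^ 2))) / 2)
        (‖a‖ * ‖b‖) := by
  have hN : 0 < ‖a‖ * ‖b‖ := mul_pos (norm_pos_iff.2 ha) (norm_pos_iff.2 hb)
  calc (fun q : ℝ => qRad q (rankOne a b)) '' Set.Icc (0 : ℝ) 1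
      = (fun θ => ‖a‖ * ‖b‖ / 2 * Real.cos (lineAngle a b - θ) + ‖a‖ * ‖b‖ / 2) ''
          Set.Icc 0 (Real.pi / 2) := by
        rw [← image_cos_Icc_zero_pi_div_two, Set.image_image]
        refine Set.image_congr fun θ hθ => ?_
        rw [qRad_cos_rankOne hdim ha b hθ]
        ring
    _ = (fun t => ‖a‖ * ‖b‖ / 2 * t + ‖a‖ * ‖b‖ / 2) ''
          Set.Icc (min (Real.cos (lineAngle a b)) (Real.sin (lineAngle a b))) 1 := by
        rw [← image_cos_sub_Icc ⟨lineAngle_nonneg a b, lineAngle_le_pi_div_two a b⟩,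
          Set.image_image]
    _ = _ := by
        rw [Set.image_affine_Icc' (half_pos hN), ← norm_mul_norm_mul_sin_lineAngle,
          ← norm_mul_norm_mul_cos_lineAngle, ← mul_min_of_nonneg _ _ hN.le]
        congr 1 <;> ring
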